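/- Let H, K be complex Hilbert spaces and R : D(R) ⊆ H → K a closed operator. Then D(R) is an operator range in H and rg R is an operator range in K. Moreover, if 𝓡 is an operator range in H, then R(𝓡 ∩ D(R)) is an operator range in K. -/

import Mathlib

/-- A subspace of a Hilbert space `X` is an operator range if it is the range of some
bounded linear operator on `X`. -/
def IsOperatorRange {X : Type*} [NormedAddCommGroup X] [InnerProductSpace ℂ X]
    (𝓡 : Set X) : Prop :=
  ∃ S : X →L[ℂ] X, 𝓡 = Set.range S

/-- One half of the Douglas range inclusion lemma. -/
lemma douglas_range_subset {E F X : Type*} [NormedAddCommGroup E] [InnerProductSpace ℂ E]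
    [CompleteSpace E] [NormedAddCommGroup F] [InnerProductSpace ℂ F] [CompleteSpace F]
    [NormedAddCommGroup X] [InnerProductSpace ℂ X] [CompleteSpace X]
    (T : E →L[ℂ] X) (S : F →L[ℂ] X)
    (h : ∀ x, ‖ContinuousLinearMap.adjoint T x‖ ≤ ‖ContinuousLinearMap.adjoint S x‖) :
    Set.range T ⊆ Set.range S := by
  rintro _ ⟨u, rfl⟩
  set A : X →ₗ[ℂ] F := (ContinuousLinearMap.adjoint S).toLinearMap with hA
  set f : X →ₗ[ℂ] ℂ := (innerSL ℂ (T u)).toLinearMap with hf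
  have hbd : ∀ x, ‖f x‖ ≤ ‖u‖ * ‖A x‖ := by
    intro x
    have h1 : f x = inner ℂ u (ContinuousLinearMap.adjoint T x) := by
      simp [hf, ContinuousLinearMap.adjoint_inner_right]
    rw [h1]
    exact (norm_inner_le_norm _ _).trans (mul_le_mul_of_nonneg_left (h x) (norm_nonneg _))
  have hker : LinearMap.ker A ≤ LinearMap.ker f := by
    intro x hx
    rw [LinearMap.mem_ker] at hx ⊢
    have := hbd x
    rw [hx, norm_zero, mul_zero] at this
    exact norm_le_zero_iff.mp this
  let g : LinearMap.range A →ₗ[ℂ] ℂ :=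
    ((LinearMap.ker A).liftQ f hker).comp (A.quotKerEquivRange.symm : _ →ₗ[ℂ] _)
  have hg : ∀ x, g ⟨A x, LinearMap.mem_range_self A x⟩ = f x := by
    intro x
    simp only [g, LinearMap.comp_apply, LinearEquiv.coe_coe]
    rw [LinearMap.quotKerEquivRange_symm_apply_image A x]
    simp
  let G : StrongDual ℂ (LinearMap.range A) := g.mkContinuous ‖u‖ (by
    rintro ⟨_, x, rfl⟩
    rw [hg]
    exact hbd x)
  obtain ⟨G', hG', -⟩ := exists_extension_norm_eq (LinearMap.range A) G
  refine ⟨(InnerProductSpace.toDual ℂ F).symm G', ?_⟩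
  refine ext_inner_right ℂ fun x => ?_
  rw [← ContinuousLinearMap.adjoint_inner_right, InnerProductSpace.toDual_symm_apply]
  have h1 := hG' ⟨A x, LinearMap.mem_range_self A x⟩
  have h2 : G ⟨A x, LinearMap.mem_range_self A x⟩ = f x := hg x
  rw [h2] at h1
  exact h1

/-- The range of a bounded operator from any Hilbert space is an operator range. -/
lemma isOperatorRange_range {E X : Type*} [NormedAddCommGroup E] [InnerProductSpace ℂ E]
    [CompleteSpace E] [NormedAddCommGroup X] [InnerProductSpace ℂ X] [CompleteSpace X]
    (T : E →L[ℂ] X) : IsOperatorRange (Set.range T) := by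
  set P : X →L[ℂ] X := T.comp (ContinuousLinearMap.adjoint T) with hP
  have hP0 : 0 ≤ P := by
    rw [ContinuousLinearMap.nonneg_iff_isPositive]
    exact ContinuousLinearMap.isPositive_self_comp_adjoint T
  set S : X →L[ℂ] X := CFC.sqrt P with hS
  have hSS : S * S = P := CFC.sqrt_mul_sqrt_self P hP0
  have hSadj : ContinuousLinearMap.adjoint S = S :=
    (IsSelfAdjoint.of_nonneg (CFC.sqrt_nonneg P)).adjoint_eq
  have hn : ∀ x, ‖ContinuousLinearMap.adjoint T x‖ = ‖ContinuousLinearMap.adjoint S x‖ := by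
    intro x
    have h1 : inner ℂ (ContinuousLinearMap.adjoint T x) (ContinuousLinearMap.adjoint T x)
        = inner ℂ (ContinuousLinearMap.adjoint S x) (ContinuousLinearMap.adjoint S x) := by
      rw [ContinuousLinearMap.adjoint_inner_left, ContinuousLinearMap.adjoint_inner_left, hSadj]
      change inner ℂ x (P x) = inner ℂ x ((S * S) x)
      rw [hSS]
    rw [inner_self_eq_norm_sq_to_K, inner_self_eq_norm_sq_to_K] at h1
    have h2 : ‖ContinuousLinearMap.adjoint T x‖ ^ 2 = ‖ContinuousLinearMap.adjoint S x‖ ^ 2 := by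
      exact_mod_cast h1
    exact (sq_eq_sq₀ (norm_nonneg _) (norm_nonneg _)).mp h2
  exact ⟨S, Set.Subset.antisymm (douglas_range_subset T S fun x => (hn x).le)
    (douglas_range_subset S T fun x => (hn x).ge)⟩

/-- Images under bounded maps of closed subspaces of `H × K` pulled back along bounded maps. -/
lemma isOperatorRange_image {H K X : Type*} [NormedAddCommGroup H] [InnerProductSpace ℂ H]
    [CompleteSpace H] [NormedAddCommGroup K] [InnerProductSpace ℂ K] [CompleteSpace K]
    [NormedAddCommGroup X] [InnerProductSpace ℂ X] [CompleteSpace X]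
    (L : Submodule ℂ (H × K)) (hL : IsClosed (L : Set (H × K)))
    (T : H × K →L[ℂ] X) : IsOperatorRange (T '' L) := by
  let e : WithLp 2 (H × K) ≃L[ℂ] H × K := WithLp.prodContinuousLinearEquiv 2 ℂ H K
  let M : Submodule ℂ (WithLp 2 (H × K)) := L.comap (e : WithLp 2 (H × K) →ₗ[ℂ] H × K)
  have hM : IsClosed (M : Set (WithLp 2 (H × K))) := hL.preimage e.continuous
  have : CompleteSpace M := hM.completeSpace_coe
  have h := isOperatorRange_range
    ((T.comp (e : WithLp 2 (H × K) →L[ℂ] H × K)).comp M.subtypeL)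
  convert h using 1
  ext y
  constructor
  · rintro ⟨z, hz, rfl⟩
    refine ⟨⟨e.symm z, ?_⟩, ?_⟩
    · change e (e.symm z) ∈ L
      simpa using hz
    · change T (e (e.symm z)) = T z
      simp
  · rintro ⟨⟨z, hz⟩, rfl⟩
    exact ⟨e z, hz, rfl⟩

/-- For a closed operator `R : D(R) ⊆ H → K` between complex Hilbert
spaces: `D(R)` is an operator range in `H`, `rg R` is an operator range in `K`, and the
image `R(𝓡 ∩ D(R))` of any operator range `𝓡` in `H` is an operator range in `K`. -/
theorem closed_operator_domain_range_operator_ranges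
    {H K : Type*} [NormedAddCommGroup H] [InnerProductSpace ℂ H] [CompleteSpace H]
    [NormedAddCommGroup K] [InnerProductSpace ℂ K] [CompleteSpace K]
    (R : H →ₗ.[ℂ] K)
    (hclosed : IsClosed (R.graph : Set (H × K))) :
    IsOperatorRange (R.domain : Set H) ∧
    IsOperatorRange (Set.range fun x : R.domain => R x) ∧
    ∀ 𝓡 : Set H, IsOperatorRange 𝓡 →
      IsOperatorRange {y : K | ∃ x : R.domain, (x : H) ∈ 𝓡 ∧ R x = y} := by
  have h3 : ∀ 𝓡 : Set H, IsOperatorRange 𝓡 →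
      IsOperatorRange {y : K | ∃ x : R.domain, (x : H) ∈ 𝓡 ∧ R x = y} := by
    rintro _ ⟨S, rfl⟩
    let A : H × K →L[ℂ] H × K := S.prodMap (ContinuousLinearMap.id ℂ K)
    have h := isOperatorRange_image (R.graph.comap (A : H × K →ₗ[ℂ] H × K))
      (hclosed.preimage A.continuous) (ContinuousLinearMap.snd ℂ H K)
    convert h using 1
    ext y
    constructor
    · rintro ⟨x, ⟨u, hu⟩, hy⟩
      refine ⟨(u, y), ?_, rfl⟩
      change (S u, y) ∈ R.graph
      rw [LinearPMap.mem_graph_iff]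
      exact ⟨x, hu.symm, hy⟩
    · rintro ⟨⟨u, k⟩, hz, rfl⟩
      have hz' : (S u, k) ∈ R.graph := hz
      rw [LinearPMap.mem_graph_iff] at hz'
      obtain ⟨x, hx, hy⟩ := hz'
      exact ⟨x, ⟨u, hx.symm⟩, hy⟩
  refine ⟨?_, ?_, h3⟩
  · have h := isOperatorRange_image R.graph hclosed (ContinuousLinearMap.fst ℂ H K)
    convert h using 1
    ext x
    constructor
    · intro hx
      exact ⟨(x, R ⟨x, hx⟩), R.mem_graph ⟨x, hx⟩, rfl⟩
    · rintro ⟨⟨a, b⟩, hz, rfl⟩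
      obtain ⟨x, hx, -⟩ := LinearPMap.mem_graph_iff R |>.mp hz
      change a ∈ R.domain
      have hx' : (x : H) = a := hx
      rw [← hx']
      exact x.2
  · have h := h3 Set.univ ⟨ContinuousLinearMap.id ℂ H, by simp⟩
    convert h using 1
    ext y
    simp
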